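/- Let Λ be the D4 lattice: {x ∈ ℤ^4 : x₁ + x₂ + x₃ + x₄ is even} with B(x,y) = −(x·y). Then: (i) the radical R ⊆ Λ/2Λ has exactly 4 elements, and q₀ vanishes on all of R (so R₁ = ∅); (ii) exactly 12 classes in Λ/2Λ satisfy q₀ = 1, and each of them contains exactly one pair ±e of roots (elements e with B(e,e) = −2). -/

import Mathlib

open Matrix

/-- The D_n lattice: integer vectors with even coordinate sum. -/
def Dn (n : ℕ) : Submodule ℤ (Fin n → ℤ) where
  carrier := {x | (2 : ℤ) ∣ ∑ i, x i}
  add_mem' := by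
    intro a b ha hb
    simpa [Finset.sum_add_distrib] using dvd_add ha hb
  zero_mem' := by simp
  smul_mem' := by
    intro c x hx
    simpa [smul_eq_mul, ← Finset.mul_sum] using hx.mul_left c

/-- The bilinear form of the D4 lattice: `B x y = -(x · y)`. -/
def D4form (x y : Dn 4) : ℤ := -((x : Fin 4 → ℤ) ⬝ᵥ (y : Fin 4 → ℤ))

/-- The submodule `2Λ ⊆ Λ`. -/
def twoSub (M : Type*) [AddCommGroup M] [Module ℤ M] : Submodule ℤ M :=
  LinearMap.range ((2 : ℤ) • (LinearMap.id : M →ₗ[ℤ] M))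

/-- The quotient `Λ/2Λ` for the D4 lattice. -/
abbrev V4 : Type := (Dn 4) ⧸ twoSub (Dn 4)

/-- `q₀(c) = 1`: the class `c` has a representative `v` with `B v v / 2` odd. -/
def q0one (c : V4) : Prop :=
  ∃ v : Dn 4, Submodule.Quotient.mk v = c ∧ (D4form v v / 2) % 2 = 1

/-- `c` lies in the radical `R`. -/
def inRad (c : V4) : Prop :=
  ∃ v : Dn 4, Submodule.Quotient.mk v = c ∧ ∀ w : Dn 4, (2 : ℤ) ∣ D4form v w

/-- `c ∈ R₁`: `c` lies in the radical and `q(c) = 1 ∈ ℤ/4`. -/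
def inR1 (c : V4) : Prop :=
  ∃ v : Dn 4, Submodule.Quotient.mk v = c ∧
    (∀ w : Dn 4, (2 : ℤ) ∣ D4form v w) ∧ (D4form v v / 2) % 4 = 1

/-- The coordinates modulo 2 of `x` in the isomorphism `x ↦ (x₀, x₁, x₂, (∑ i, x i) / 2)` of the
D4 lattice with `ℤ⁴`. -/
def parity (x : Dn 4) : Fin 4 → ZMod 2 :=
  ![((x.1 0 : ℤ) : ZMod 2), ((x.1 1 : ℤ) : ZMod 2), ((x.1 2 : ℤ) : ZMod 2),
    (((∑ i, x.1 i) / 2 : ℤ) : ZMod 2)]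

/-- A lattice vector with prescribed `parity`. -/
def parityLift (p : Fin 4 → ZMod 2) : Dn 4 :=
  ⟨![((p 0).val : ℤ), ((p 1).val : ℤ), ((p 2).val : ℤ),
    2 * ((p 3).val : ℤ) - (p 0).val - (p 1).val - (p 2).val], by
    change (2 : ℤ) ∣ ∑ i, _
    simp only [Fin.sum_univ_four, cons_val]
    exact ⟨((p 3).val : ℤ), by ring⟩⟩

theorem parity_parityLift (p : Fin 4 → ZMod 2) : parity (parityLift p) = p := by
  funext i
  fin_cases i <;> simp [parity, parityLift, Fin.sum_univ_four]

theorem two_dvd_sum (v : Dn 4) : (2 : ℤ) ∣ v.1 0 + v.1 1 + v.1 2 + v.1 3 := by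
  have h : (2 : ℤ) ∣ ∑ i, v.1 i := v.2
  rwa [Fin.sum_univ_four] at h

theorem D4form_eq (x y : Dn 4) :
    D4form x y = -(x.1 0 * y.1 0 + x.1 1 * y.1 1 + x.1 2 * y.1 2 + x.1 3 * y.1 3) := by
  simp [D4form, dotProduct, Fin.sum_univ_four]

theorem mk_eq_mk_iff (v w : Dn 4) :
    (Submodule.Quotient.mk v : V4) = Submodule.Quotient.mk w ↔ ∃ u : Dn 4, v - w = (2 : ℤ) • u := by
  rw [Submodule.Quotient.eq]
  simp [twoSub, LinearMap.mem_range, eq_comm]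

theorem mk_eq_mk_iff_parity (v w : Dn 4) :
    (Submodule.Quotient.mk v : V4) = Submodule.Quotient.mk w ↔ parity v = parity w := by
  have hv := two_dvd_sum v
  have hw := two_dvd_sum w
  rw [mk_eq_mk_iff]
  simp only [parity, Fin.sum_univ_four, vecCons_inj, ZMod.intCast_eq_intCast_iff,
    Int.modEq_iff_dvd, Nat.cast_ofNat, and_true]
  constructor
  · rintro ⟨u, hu⟩
    have h : ∀ i, v.1 i - w.1 i = 2 * u.1 i := fun i => by
      simpa using congrFun (congrArg Subtype.val hu) i
    have hu := two_dvd_sum u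
    have := h 0
    have := h 1
    have := h 2
    have := h 3
    omega
  · rintro ⟨h0, h1, h2, h3⟩
    refine ⟨⟨fun i => (v.1 i - w.1 i) / 2, ?_⟩, ?_⟩
    · change (2 : ℤ) ∣ ∑ i, (v.1 i - w.1 i) / 2
      rw [Fin.sum_univ_four]
      omega
    · ext i
      simp only [Submodule.coe_sub, Submodule.coe_smul, Pi.sub_apply, Pi.smul_apply, smul_eq_mul]
      fin_cases i <;> simp only [Fin.zero_eta, Fin.mk_one, Fin.reduceFinMk] <;> omega

/-- `Λ/2Λ` is `(ℤ/2)⁴`. -/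
noncomputable def parityEquiv : (Fin 4 → ZMod 2) ≃ V4 :=
  Equiv.ofBijective (fun p => Submodule.Quotient.mk (parityLift p)) <| by
    constructor
    · intro p p' h
      simpa only [mk_eq_mk_iff_parity, parity_parityLift] using h
    · intro c
      obtain ⟨v, rfl⟩ := Submodule.Quotient.mk_surjective _ c
      exact ⟨parity v, by rw [mk_eq_mk_iff_parity, parity_parityLift]⟩

theorem parityEquiv_parity (v : Dn 4) : parityEquiv (parity v) = Submodule.Quotient.mk v := by
  change Submodule.Quotient.mk (parityLift (parity v)) = _
  rw [mk_eq_mk_iff_parity, parity_parityLift]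

theorem intCast_zmod_two_eq_iff (a b : ℤ) : (a : ZMod 2) = b ↔ a % 2 = b % 2 :=
  ZMod.intCast_eq_intCast_iff a b 2

theorem radical_iff_parity (v : Dn 4) :
    (∀ w : Dn 4, (2 : ℤ) ∣ D4form v w) ↔
      parity v 0 = parity v 1 ∧ parity v 1 = parity v 2 := by
  simp only [parity, cons_val, intCast_zmod_two_eq_iff]
  have hv := two_dvd_sum v
  constructor
  · intro h
    have h1 := h ⟨![1, 1, 0, 0], by change (2 : ℤ) ∣ ∑ i, _; simp [Fin.sum_univ_four]⟩
    have h2 := h ⟨![0, 1, 1, 0], by change (2 : ℤ) ∣ ∑ i, _; simp [Fin.sum_univ_four]⟩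
    simp only [D4form_eq, cons_val] at h1 h2
    omega
  · rintro ⟨h0, h1⟩ w
    have hw := two_dvd_sum w
    rw [D4form_eq, dvd_neg]
    obtain ⟨a, ha⟩ : (2 : ℤ) ∣ v.1 1 - v.1 0 := by omega
    obtain ⟨b, hb⟩ : (2 : ℤ) ∣ v.1 2 - v.1 0 := by omega
    obtain ⟨c, hc⟩ : (2 : ℤ) ∣ v.1 3 - v.1 0 := by omega
    obtain ⟨d, hd⟩ := hw
    exact ⟨v.1 0 * d + a * w.1 1 + b * w.1 2 + c * w.1 3, by
      linear_combination v.1 0 * hd + w.1 1 * ha + w.1 2 * hb + w.1 3 * hc⟩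

/-- The quadratic form `q₀` in the coordinates `parity`. -/
def parityForm (p : Fin 4 → ZMod 2) : ZMod 2 :=
  p 0 ^ 2 + p 1 ^ 2 + p 2 ^ 2 + p 0 * p 1 + p 0 * p 2 + p 1 * p 2

theorem half_D4form (v : Dn 4) : ((D4form v v / 2 : ℤ) : ZMod 2) = parityForm (parity v) := by
  obtain ⟨s, hs⟩ := two_dvd_sum v
  have h : D4form v v = 2 * (-(v.1 0 ^ 2 + v.1 1 ^ 2 + v.1 2 ^ 2 + v.1 0 * v.1 1 + v.1 0 * v.1 2
      + v.1 1 * v.1 2) + 2 * (s * (v.1 0 + v.1 1 + v.1 2) - s ^ 2)) := by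
    rw [D4form_eq, show v.1 3 = 2 * s - v.1 0 - v.1 1 - v.1 2 by linarith]
    ring
  rw [h, Int.mul_ediv_cancel_left _ two_ne_zero]
  have h2 : (2 : ZMod 2) = 0 := rfl
  simp only [parityForm, parity, cons_val]
  push_cast
  rw [h2, zero_mul, add_zero, CharTwo.neg_eq]

theorem half_D4form_emod_two (v : Dn 4) :
    (D4form v v / 2) % 2 = 1 ↔ parityForm (parity v) = 1 := by
  rw [← half_D4form, ← Int.cast_one (R := ZMod 2), intCast_zmod_two_eq_iff]
  rfl

theorem inRad_parityEquiv (p : Fin 4 → ZMod 2) :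
    inRad (parityEquiv p) ↔ p 0 = p 1 ∧ p 1 = p 2 := by
  constructor
  · rintro ⟨v, hv, h⟩
    rw [← parityEquiv_parity, EmbeddingLike.apply_eq_iff_eq] at hv
    exact hv ▸ (radical_iff_parity v).1 h
  · intro h
    exact ⟨parityLift p, rfl, (radical_iff_parity _).2 (by rwa [parity_parityLift])⟩

theorem q0one_parityEquiv (p : Fin 4 → ZMod 2) :
    q0one (parityEquiv p) ↔ parityForm p = 1 := by
  constructor
  · rintro ⟨v, hv, h⟩
    rw [← parityEquiv_parity, EmbeddingLike.apply_eq_iff_eq] at hv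
    exact hv ▸ (half_D4form_emod_two v).1 h
  · intro h
    exact ⟨parityLift p, rfl, (half_D4form_emod_two _).2 (by rwa [parity_parityLift])⟩

theorem card_inRad : Nat.card {c : V4 // inRad c} = 4 := by
  rw [← Nat.card_congr (parityEquiv.subtypeEquiv fun p => (inRad_parityEquiv p).symm),
    Nat.card_eq_fintype_card]
  decide

theorem card_q0one : Nat.card {c : V4 // q0one c} = 12 := by
  rw [← Nat.card_congr (parityEquiv.subtypeEquiv fun p => (q0one_parityEquiv p).symm),
    Nat.card_eq_fintype_card]
  unfold parityForm
  decide

theorem parityForm_ne_one :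
    ∀ p : Fin 4 → ZMod 2, p 0 = p 1 ∧ p 1 = p 2 → parityForm p ≠ 1 := by
  unfold parityForm
  decide

theorem not_q0one_of_inRad (c : V4) (hc : inRad c) : ¬ q0one c := by
  obtain ⟨p, rfl⟩ := parityEquiv.surjective c
  rw [inRad_parityEquiv] at hc
  rw [q0one_parityEquiv]
  exact parityForm_ne_one p hc

theorem not_inR1 (c : V4) : ¬ inR1 c := by
  rintro ⟨v, hv, hrad, h⟩
  exact not_q0one_of_inRad c ⟨v, hv, hrad⟩ ⟨v, hv, by omega⟩

/-- The root `eᵢ + eⱼ` or `eᵢ - eⱼ`. -/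
def pairRoot (i j : Fin 4) (plus : Bool) : Dn 4 :=
  ⟨Pi.single i 1 + Pi.single j (if plus then 1 else -1), by
    change (2 : ℤ) ∣ ∑ i, _
    cases plus <;> simp [Finset.sum_add_distrib]⟩

theorem D4form_pairRoot {i j : Fin 4} (hij : i ≠ j) (plus : Bool) :
    D4form (pairRoot i j plus) (pairRoot i j plus) = -2 := by
  cases plus <;> simp [D4form, pairRoot, hij, hij.symm]

theorem exists_parity_pairRoot :
    ∀ p : Fin 4 → ZMod 2, parityForm p = 1 → ∃ i j plus, i ≠ j ∧ parity (pairRoot i j plus) = p := by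
  unfold parityForm
  decide

theorem even_D4form_self (v : Dn 4) : (2 : ℤ) ∣ D4form v v := by
  obtain ⟨s, hs⟩ := two_dvd_sum v
  rw [D4form_eq, show v.1 3 = 2 * s - v.1 0 - v.1 1 - v.1 2 by linarith]
  exact ⟨-(v.1 0 ^ 2 + v.1 1 ^ 2 + v.1 2 ^ 2 + v.1 0 * v.1 1 + v.1 0 * v.1 2
      + v.1 1 * v.1 2) + 2 * (s * (v.1 0 + v.1 1 + v.1 2) - s ^ 2), by ring⟩

theorem D4form_self_nonpos (v : Dn 4) : D4form v v ≤ 0 := by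
  rw [D4form_eq]
  nlinarith [mul_self_nonneg (v.1 0), mul_self_nonneg (v.1 1), mul_self_nonneg (v.1 2),
    mul_self_nonneg (v.1 3)]

theorem eq_zero_of_D4form_self {v : Dn 4} (h : D4form v v = 0) : v = 0 :=
  Subtype.ext (dotProduct_self_eq_zero.1 (neg_eq_zero.1 h))

/-- Two congruent roots agree up to sign: if `e' - e = 2u`, then `e' + e = 2(u + e)`, and by the
parallelogram law the even norms of `u` and `u + e` sum to `2`. -/
theorem root_eq_or_eq_neg {e e' : Dn 4} (he : D4form e e = -2) (he' : D4form e' e' = -2)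
    (h : (Submodule.Quotient.mk e' : V4) = Submodule.Quotient.mk e) : e' = e ∨ e' = -e := by
  obtain ⟨u, hu⟩ := (mk_eq_mk_iff _ _).1 h
  obtain rfl : e' = e + (2 : ℤ) • u := by rw [← hu]; abel
  have hsum : D4form u u + D4form (u + e) (u + e) = -2 := by
    simp only [D4form_eq, Submodule.coe_add, Submodule.coe_smul, Pi.add_apply, Pi.smul_apply,
      smul_eq_mul] at he he' ⊢
    linarith
  have := even_D4form_self u
  have := even_D4form_self (u + e)
  have := D4form_self_nonpos u
  have := D4form_self_nonpos (u + e)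
  obtain h0 | h0 : D4form u u = 0 ∨ D4form (u + e) (u + e) = 0 := by omega
  · left
    simp [eq_zero_of_D4form_self h0]
  · right
    rw [eq_neg_of_add_eq_zero_left (eq_zero_of_D4form_self h0)]
    module

/-- For the D4 lattice: (i) the radical of `Λ/2Λ` has exactly 4
elements, `q₀` vanishes on all of it, and `R₁ = ∅`; (ii) exactly 12 classes satisfy
`q₀ = 1`, and each of them contains exactly one pair `±e` of roots. -/
theorem stmt_7 :
    (Nat.card {c : V4 // inRad c} = 4 ∧
      (∀ c : V4, inRad c → ¬ q0one c) ∧ (∀ c : V4, ¬ inR1 c)) ∧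
    (Nat.card {c : V4 // q0one c} = 12 ∧
      ∀ c : V4, q0one c →
        ∃ e : Dn 4, Submodule.Quotient.mk e = c ∧ D4form e e = -2 ∧
          ∀ e' : Dn 4, Submodule.Quotient.mk e' = c → D4form e' e' = -2 →
            e' = e ∨ e' = -e) := by
  refine ⟨⟨card_inRad, not_q0one_of_inRad, not_inR1⟩, card_q0one, fun c hc => ?_⟩
  obtain ⟨p, rfl⟩ := parityEquiv.surjective c
  obtain ⟨i, j, plus, hij, rfl⟩ := exists_parity_pairRoot p ((q0one_parityEquiv p).1 hc)
  rw [parityEquiv_parity]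
  exact ⟨_, rfl, D4form_pairRoot hij plus,
    fun e' h he' => root_eq_or_eq_neg (D4form_pairRoot hij plus) he' h⟩
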